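/- Let d n be natural numbers, let a : Fin n → EuclideanSpace ℝ (Fin d) and y : Fin n → ℝ, and for each i let f i (β) = (⟪a i, β⟫ - y i)^2. Let I be a nonempty finite subset of Fin n, let β* minimize β ↦ max_{i ∈ I} f i (β) with optimal value δ_opt, and let J ⊆ I be a subset such that f i (β*) < δ_opt for every i ∈ J. Then I \ J is nonempty, max_{i ∈ I \ J} f i (β*) = δ_opt, and for every β, max_{i ∈ I \ J} f i (β) ≥ δ_opt; that is, simultaneously removing any set of measurements disjoint from the support set leaves the optimal minimax residual unchanged. -/

import Mathlib

open RealInnerProductSpace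

open Filter Topology in
/-- Near the left end of a segment, finitely many continuous functions that are `< c` there, and
finitely many convex functions that are `≤ c` there and `< c` at the other end, are all `< c`. -/
lemma exists_forall_lt_of_convexOn_of_continuous {ι E : Type*} [AddCommGroup E] [Module ℝ E]
    [TopologicalSpace E] [ContinuousAdd E] [ContinuousSMul ℝ E] {f : ι → E → ℝ} {s t : Finset ι}
    {c : ℝ} {x z : E} (hcont : ∀ i ∈ t, Continuous (f i)) (htx : ∀ i ∈ t, f i x < c)
    (hconv : ∀ i ∈ s, ConvexOn ℝ Set.univ (f i)) (hsx : ∀ i ∈ s, f i x ≤ c)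
    (hsz : ∀ i ∈ s, f i z < c) :
    ∃ w, (∀ i ∈ s, f i w < c) ∧ ∀ i ∈ t, f i w < c := by
  have near : ∀ᶠ r : ℝ in 𝓝[>] 0, ∀ i ∈ t, f i ((1 - r) • x + r • z) < c := by
    refine nhdsWithin_le_nhds ((Finset.eventually_all t).2 fun i hi => ?_)
    have hi_cont : Continuous fun r : ℝ => f i ((1 - r) • x + r • z) :=
      (hcont i hi).comp (by fun_prop)
    exact hi_cont.continuousAt.eventually_lt continuousAt_const (by simpa using htx i hi)
  obtain ⟨r, hr, hr0, hr1⟩ :=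
    (near.and (Ioo_mem_nhdsGT (zero_lt_one' ℝ))).exists
  refine ⟨(1 - r) • x + r • z, fun i hi => ?_, hr⟩
  have hle := (hconv i hi).2 (Set.mem_univ x) (Set.mem_univ z) (sub_nonneg.2 hr1.le) hr0.le
    (sub_add_cancel 1 r)
  simp only [smul_eq_mul] at hle
  nlinarith [mul_le_mul_of_nonneg_left (hsx i hi) (sub_nonneg.2 hr1.le),
    mul_lt_mul_of_pos_left (hsz i hi) hr0]

lemma convexOn_inner_sub_sq {E : Type*} [NormedAddCommGroup E] [InnerProductSpace ℝ E]
    (a : E) (y : ℝ) : ConvexOn ℝ Set.univ fun x : E => (⟪a, x⟫ - y) ^ 2 := by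
  have hsq : ConvexOn ℝ Set.univ fun u : ℝ => (u + -y) ^ 2 := by
    simpa [Function.comp_def] using (even_two.convexOn_pow (𝕜 := ℝ)).translate_left (-y)
  simpa [Function.comp_def, sub_eq_add_neg] using hsq.comp_linearMap (innerSL ℝ a).toLinearMap

/-- Simultaneously removing any set `J` of measurements disjoint from the
support set of the `L∞` minimax problem with squared residuals leaves the
optimal minimax residual unchanged. -/
theorem linf_remove_non_support_set_sq
    (d n : ℕ) (a : Fin n → EuclideanSpace ℝ (Fin d)) (y : Fin n → ℝ)
    (f : Fin n → EuclideanSpace ℝ (Fin d) → ℝ)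
    (hf : ∀ i β, f i β = (⟪a i, β⟫ - y i) ^ 2)
    (I : Finset (Fin n)) (hI : I.Nonempty)
    (βstar : EuclideanSpace ℝ (Fin d))
    (hmin : ∀ β, I.sup' hI (fun i => f i βstar) ≤ I.sup' hI (fun i => f i β))
    (δopt : ℝ) (hδ : δopt = I.sup' hI (fun i => f i βstar))
    (J : Finset (Fin n)) (hJ : J ⊆ I) (hJlt : ∀ i ∈ J, f i βstar < δopt) :
    ∃ hne : (I \ J).Nonempty,
      (I \ J).sup' hne (fun i => f i βstar) = δopt ∧
      ∀ β, δopt ≤ (I \ J).sup' hne (fun i => f i β) := by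
  subst hδ
  obtain ⟨k, hkI, hk⟩ := I.exists_mem_eq_sup' hI fun i => f i βstar
  have hkJ : k ∈ I \ J := Finset.mem_sdiff.2 ⟨hkI, fun hkJ => (hJlt k hkJ).ne hk.symm⟩
  have hle : ∀ i ∈ I \ J, f i βstar ≤ I.sup' hI fun i => f i βstar := fun i hi =>
    I.le_sup' (fun i => f i βstar) (Finset.mem_sdiff.1 hi).1
  refine ⟨⟨k, hkJ⟩, le_antisymm (Finset.sup'_le _ _ hle)
    (hk.trans_le (Finset.le_sup' (fun i => f i βstar) hkJ)), fun β => ?_⟩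
  by_contra! hβ
  have hf' : ∀ i, f i = fun β => (⟪a i, β⟫ - y i) ^ 2 := fun i => funext (hf i)
  obtain ⟨w, hw, hwJ⟩ := exists_forall_lt_of_convexOn_of_continuous (f := f)
    (fun i _ => by rw [hf' i]; fun_prop) hJlt
    (fun i _ => by rw [hf' i]; exact convexOn_inner_sub_sq (a i) (y i)) hle
    ((Finset.sup'_lt_iff _).1 hβ)
  refine (hmin w).not_gt ((Finset.sup'_lt_iff hI).2 fun i hi => ?_)
  by_cases hiJ : i ∈ J
  · exact hwJ i hiJ
  · exact hw i (Finset.mem_sdiff.2 ⟨hi, hiJ⟩)
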